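/- Let K be a field, 𝕋 the K-vector space with basis the weighted planar binary trees together with an extra basis vector 𝟙, with grafting ∨, weight-shift α, coproduct Δ and counit ε as defined. Let I ⊆ 𝕋 be the two-sided ∨-ideal generated by the elements (u∨v)∨α(w) − α(u)∨(v∨w), where u, v, w range over all weighted trees and 𝟙 (i.e. the smallest subspace containing these generators and stable under x ↦ t∨x and x ↦ x∨t for all t ∈ 𝕋). Then I is a coideal of the coalgebra (𝕋,Δ,ε): ε(I) = 0 and Δ(I) ⊆ I⊗𝕋 + 𝕋⊗I. -/

import Mathlib

open TensorProduct

/-- Weighted planar binary trees: a leaf carrying a weight in `ℕ`, or a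
grafting of two weighted trees. -/
inductive WTree : Type
  | leaf : ℕ → WTree
  | node : WTree → WTree → WTree

/-- Add `1` to every leaf weight of a weighted tree. -/
def WTree.shift : WTree → WTree
  | .leaf a => .leaf (a + 1)
  | .node s t => .node s.shift t.shift

/-- Basis of the space `𝕋`: the weighted trees together with the extra basis
vector `𝟙` (encoded as `none`). -/
abbrev TreeBasis : Type := Option WTree

/-- The weight-shift on basis elements: `α(𝟙) = 𝟙`, and `+1` on all leaf
weights of a tree. -/
def TreeBasis.shift : TreeBasis → TreeBasis
  | none => none
  | some t => some t.shift

/-- Grafting of basis elements: `𝟙⋆𝟙 = 𝟙`, `𝟙⋆τ = τ⋆𝟙 = α(τ)`, and grafting of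
trees otherwise. -/
def TreeBasis.graft : TreeBasis → TreeBasis → TreeBasis
  | none, none => none
  | none, some t => some t.shift
  | some t, none => some t.shift
  | some s, some t => some (WTree.node s t)

variable (K : Type*) [Field K]

/-- The `K`-vector space `𝕋` with basis the weighted trees together with `𝟙`. -/
abbrev TreeSpace : Type _ := TreeBasis →₀ K

/-- Basis vectors of `𝕋`. -/
noncomputable def treeVec (s : TreeBasis) : TreeSpace K := Finsupp.single s 1

/-- The weight-shift map `α : 𝕋 → 𝕋`. -/
noncomputable def treeAlpha : TreeSpace K →ₗ[K] TreeSpace K :=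
  Finsupp.lmapDomain K K TreeBasis.shift

/-- The bilinear grafting product `∨ : 𝕋 → 𝕋 → 𝕋`. -/
noncomputable def treeVee : TreeSpace K →ₗ[K] TreeSpace K →ₗ[K] TreeSpace K :=
  Finsupp.lift (TreeSpace K →ₗ[K] TreeSpace K) K TreeBasis fun s =>
    Finsupp.lift (TreeSpace K) K TreeBasis fun t => Finsupp.single (s.graft t) 1

/-- The componentwise product on `𝕋 ⊗ 𝕋`: `(a⊗b) ∨ (c⊗d) = (a∨c)⊗(b∨d)`. -/
noncomputable def treeVee2 :
    (TreeSpace K ⊗[K] TreeSpace K) →ₗ[K] (TreeSpace K ⊗[K] TreeSpace K) →ₗ[K]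
      (TreeSpace K ⊗[K] TreeSpace K) :=
  TensorProduct.map₂ (treeVee K) (treeVee K)

/-- The coproduct on weighted trees, `Δ(φ) = Σ_I φ_I ⊗ φ_{I^c}`: on a leaf it
is `leaf ⊗ 𝟙 + 𝟙 ⊗ leaf`, and on a grafting it is given componentwise, in
accordance with `(φ∨ψ)_I = φ_{I₁} ⋆ ψ_{I₂}`. -/
noncomputable def deltaTree : WTree → TreeSpace K ⊗[K] TreeSpace K
  | .leaf a =>
      treeVec K (some (.leaf a)) ⊗ₜ[K] treeVec K none
        + treeVec K none ⊗ₜ[K] treeVec K (some (.leaf a))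
  | .node s t => treeVee2 K (deltaTree s) (deltaTree t)

/-- The coproduct on basis elements, with `Δ(𝟙) = 𝟙 ⊗ 𝟙`. -/
noncomputable def deltaBasis : TreeBasis → TreeSpace K ⊗[K] TreeSpace K
  | none => treeVec K none ⊗ₜ[K] treeVec K none
  | some t => deltaTree K t

/-- The coproduct `Δ : 𝕋 → 𝕋 ⊗ 𝕋`. -/
noncomputable def treeDelta : TreeSpace K →ₗ[K] TreeSpace K ⊗[K] TreeSpace K :=
  Finsupp.lift (TreeSpace K ⊗[K] TreeSpace K) K TreeBasis (deltaBasis K)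

/-- The counit `ε : 𝕋 → K`, `ε(𝟙) = 1` and `ε(φ) = 0` on weighted trees (the
coefficient of `𝟙`). -/
noncomputable def treeEps : TreeSpace K →ₗ[K] K := Finsupp.lapply none

/-- The generators `(u∨v)∨α(w) − α(u)∨(v∨w)` of the Hom-associativity ideal,
with `u,v,w` ranging over weighted trees and `𝟙`. -/
noncomputable def assocGenSet : Set (TreeSpace K) :=
  { z | ∃ u v w : TreeBasis,
      z = treeVee K (treeVee K (treeVec K u) (treeVec K v)) (treeAlpha K (treeVec K w))
          - treeVee K (treeAlpha K (treeVec K u)) (treeVee K (treeVec K v) (treeVec K w)) }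

/-- The two-sided `∨`-ideal generated by the Hom-associativity generators: the
smallest subspace containing them and stable under left and right `∨`-
multiplication by every element of `𝕋`. -/
noncomputable def assocIdeal : Submodule K (TreeSpace K) :=
  sInf { P : Submodule K (TreeSpace K) |
    assocGenSet K ⊆ (P : Set (TreeSpace K)) ∧
    (∀ t : TreeSpace K, ∀ x ∈ P, treeVee K t x ∈ P) ∧
    (∀ t : TreeSpace K, ∀ x ∈ P, treeVee K x t ∈ P) }

theorem treeVee_treeVec (s t : TreeBasis) :
    treeVee K (treeVec K s) (treeVec K t) = treeVec K (s.graft t) := by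
  simp [treeVee, treeVec]

theorem treeAlpha_treeVec (s : TreeBasis) :
    treeAlpha K (treeVec K s) = treeVec K s.shift := by
  simp [treeAlpha, treeVec]

theorem treeDelta_treeVec (s : TreeBasis) :
    treeDelta K (treeVec K s) = deltaBasis K s := by
  simp [treeDelta, treeVec]

/-- Two linear maps on `𝕋` agreeing on the basis vectors are equal. -/
theorem treeSpace_hom_ext {M : Type*} [AddCommMonoid M] [Module K M]
    {f g : TreeSpace K →ₗ[K] M} (h : ∀ s, f (treeVec K s) = g (treeVec K s)) : f = g :=
  Finsupp.lhom_ext' fun s => LinearMap.ext_ring (h s)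

theorem treeVec_induction {p : TreeSpace K → Prop} (x : TreeSpace K) (zero : p 0)
    (add : ∀ x y, p x → p y → p (x + y)) (smul : ∀ (c : K) x, p x → p (c • x))
    (basis : ∀ s, p (treeVec K s)) : p x := by
  induction x using Finsupp.induction_linear with
  | zero => exact zero
  | add x y hx hy => exact add x y hx hy
  | single s c =>
    have h := smul c _ (basis s)
    rwa [treeVec, Finsupp.smul_single, smul_eq_mul, mul_one] at h

theorem TreeBasis.shift_graft (s t : TreeBasis) :
    (s.graft t).shift = s.shift.graft t.shift := by
  cases s <;> cases t <;> rfl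

theorem TreeBasis.none_graft (t : TreeBasis) : TreeBasis.graft none t = t.shift := by
  cases t <;> rfl

theorem TreeBasis.graft_none (t : TreeBasis) : TreeBasis.graft t none = t.shift := by
  cases t <;> rfl

theorem treeVee_none_left : treeVee K (treeVec K none) = treeAlpha K :=
  treeSpace_hom_ext K fun t => by
    rw [treeVee_treeVec, treeAlpha_treeVec, TreeBasis.none_graft]

theorem treeVee_none_right : (treeVee K).flip (treeVec K none) = treeAlpha K :=
  treeSpace_hom_ext K fun t => by
    rw [LinearMap.flip_apply, treeVee_treeVec, treeAlpha_treeVec, TreeBasis.graft_none]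

theorem treeAlpha_treeVee (x y : TreeSpace K) :
    treeAlpha K (treeVee K x y) = treeVee K (treeAlpha K x) (treeAlpha K y) := by
  have h : (treeVee K).compr₂ (treeAlpha K)
      = (treeVee K).compl₁₂ (treeAlpha K) (treeAlpha K) :=
    treeSpace_hom_ext K fun s => treeSpace_hom_ext K fun t => by
      simp [treeVee_treeVec, treeAlpha_treeVec, TreeBasis.shift_graft]
  exact LinearMap.congr_fun₂ h x y

/-- The weight-shift `α ⊗ α` on `𝕋 ⊗ 𝕋`. -/
noncomputable def treeAlpha2 :
    (TreeSpace K ⊗[K] TreeSpace K) →ₗ[K] (TreeSpace K ⊗[K] TreeSpace K) :=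
  TensorProduct.map (treeAlpha K) (treeAlpha K)

theorem treeVee2_tmul (a b c d : TreeSpace K) :
    treeVee2 K (a ⊗ₜ b) (c ⊗ₜ d) = treeVee K a c ⊗ₜ treeVee K b d := rfl

theorem treeAlpha2_tmul (a b : TreeSpace K) :
    treeAlpha2 K (a ⊗ₜ b) = treeAlpha K a ⊗ₜ treeAlpha K b := rfl

theorem treeAlpha2_treeVee2 (x y : TreeSpace K ⊗[K] TreeSpace K) :
    treeAlpha2 K (treeVee2 K x y) = treeVee2 K (treeAlpha2 K x) (treeAlpha2 K y) := by
  induction x using TensorProduct.induction_on with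
  | zero => simp
  | add x x' hx hx' => simp only [map_add, LinearMap.add_apply, hx, hx']
  | tmul a b =>
    induction y using TensorProduct.induction_on with
    | zero => simp
    | add y y' hy hy' => simp only [map_add, hy, hy']
    | tmul c d => simp only [treeVee2_tmul, treeAlpha2_tmul, treeAlpha_treeVee]

theorem treeVee2_none_left (x : TreeSpace K ⊗[K] TreeSpace K) :
    treeVee2 K (treeVec K none ⊗ₜ treeVec K none) x = treeAlpha2 K x := by
  induction x using TensorProduct.induction_on with
  | zero => simp
  | add x x' hx hx' => simp only [map_add, hx, hx']
  | tmul a b => rw [treeVee2_tmul, treeVee_none_left, treeAlpha2_tmul]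

theorem treeVee2_none_right (x : TreeSpace K ⊗[K] TreeSpace K) :
    treeVee2 K x (treeVec K none ⊗ₜ treeVec K none) = treeAlpha2 K x := by
  induction x using TensorProduct.induction_on with
  | zero => simp
  | add x x' hx hx' => simp only [map_add, LinearMap.add_apply, hx, hx']
  | tmul a b =>
    rw [treeVee2_tmul, treeAlpha2_tmul, ← treeVee_none_right]
    rfl

theorem deltaTree_shift (t : WTree) :
    deltaTree K t.shift = treeAlpha2 K (deltaTree K t) := by
  induction t with
  | leaf a =>
    simp only [WTree.shift, deltaTree, map_add, treeAlpha2_tmul, treeAlpha_treeVec,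
      TreeBasis.shift]
  | node s t hs ht => simp only [WTree.shift, deltaTree, hs, ht, treeAlpha2_treeVee2]

theorem deltaBasis_shift (s : TreeBasis) :
    deltaBasis K s.shift = treeAlpha2 K (deltaBasis K s) := by
  cases s with
  | none => simp only [TreeBasis.shift, deltaBasis, treeAlpha2_tmul, treeAlpha_treeVec]
  | some t => exact deltaTree_shift K t

theorem deltaBasis_graft (s t : TreeBasis) :
    deltaBasis K (s.graft t) = treeVee2 K (deltaBasis K s) (deltaBasis K t) := by
  cases s with
  | none =>
    rw [TreeBasis.none_graft, deltaBasis_shift]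
    exact (treeVee2_none_left K _).symm
  | some s =>
    cases t with
    | none =>
      rw [TreeBasis.graft_none, deltaBasis_shift]
      exact (treeVee2_none_right K _).symm
    | some t => rfl

theorem treeDelta_treeVee (x y : TreeSpace K) :
    treeDelta K (treeVee K x y) = treeVee2 K (treeDelta K x) (treeDelta K y) := by
  have h : (treeVee K).compr₂ (treeDelta K)
      = (treeVee2 K).compl₁₂ (treeDelta K) (treeDelta K) :=
    treeSpace_hom_ext K fun s => treeSpace_hom_ext K fun t => by
      simp [treeVee_treeVec, treeDelta_treeVec, deltaBasis_graft]
  exact LinearMap.congr_fun₂ h x y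

theorem treeDelta_treeAlpha (x : TreeSpace K) :
    treeDelta K (treeAlpha K x) = treeAlpha2 K (treeDelta K x) := by
  have h : treeDelta K ∘ₗ treeAlpha K = treeAlpha2 K ∘ₗ treeDelta K :=
    treeSpace_hom_ext K fun s => by
      simp [treeAlpha_treeVec, treeDelta_treeVec, deltaBasis_shift]
  exact LinearMap.congr_fun h x

theorem treeEps_treeVee (x y : TreeSpace K) :
    treeEps K (treeVee K x y) = treeEps K x * treeEps K y := by
  have h : (treeVee K).compr₂ (treeEps K)
      = (LinearMap.mul K K).compl₁₂ (treeEps K) (treeEps K) :=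
    treeSpace_hom_ext K fun s => treeSpace_hom_ext K fun t => by
      simp only [LinearMap.compr₂_apply, LinearMap.compl₁₂_apply, treeVee_treeVec]
      cases s <;> cases t <;> simp [TreeBasis.graft, treeEps, treeVec]
  exact LinearMap.congr_fun₂ h x y

theorem treeEps_treeAlpha (x : TreeSpace K) : treeEps K (treeAlpha K x) = treeEps K x := by
  rw [← treeVee_none_left, treeEps_treeVee]
  simp [treeEps, treeVec]

theorem treeVee_mem_assocIdeal_right (t : TreeSpace K) {x : TreeSpace K}
    (hx : x ∈ assocIdeal K) : treeVee K t x ∈ assocIdeal K := by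
  rw [assocIdeal, Submodule.mem_sInf] at hx ⊢
  exact fun P hP => hP.2.1 t x (hx P hP)

theorem treeVee_mem_assocIdeal_left {x : TreeSpace K} (hx : x ∈ assocIdeal K)
    (t : TreeSpace K) : treeVee K x t ∈ assocIdeal K := by
  rw [assocIdeal, Submodule.mem_sInf] at hx ⊢
  exact fun P hP => hP.2.2 t x (hx P hP)

theorem assocIdeal_le {P : Submodule K (TreeSpace K)} (hgen : assocGenSet K ⊆ P)
    (hl : ∀ t, ∀ x ∈ P, treeVee K t x ∈ P) (hr : ∀ t, ∀ x ∈ P, treeVee K x t ∈ P) :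
    assocIdeal K ≤ P :=
  sInf_le ⟨hgen, hl, hr⟩

/-- The Hom-associator of arbitrary elements of `𝕋` lies in the ideal. -/
theorem homAssociator_mem_assocIdeal (a b c : TreeSpace K) :
    treeVee K (treeVee K a b) (treeAlpha K c) - treeVee K (treeAlpha K a) (treeVee K b c)
      ∈ assocIdeal K := by
  induction a using treeVec_induction with
  | zero => simp
  | add x y hx hy =>
    simpa only [map_add, LinearMap.add_apply, add_sub_add_comm] using add_mem hx hy
  | smul r x hx =>
    simpa only [map_smul, LinearMap.smul_apply, smul_sub] using
      Submodule.smul_mem _ r hx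
  | basis u =>
  induction b using treeVec_induction with
  | zero => simp
  | add x y hx hy =>
    simpa only [map_add, LinearMap.add_apply, add_sub_add_comm] using add_mem hx hy
  | smul r x hx =>
    simpa only [map_smul, LinearMap.smul_apply, smul_sub] using
      Submodule.smul_mem _ r hx
  | basis v =>
  induction c using treeVec_induction with
  | zero => simp
  | add x y hx hy =>
    simpa only [map_add, LinearMap.add_apply, add_sub_add_comm] using add_mem hx hy
  | smul r x hx =>
    simpa only [map_smul, LinearMap.smul_apply, smul_sub] using
      Submodule.smul_mem _ r hx
  | basis w =>
    rw [assocIdeal, Submodule.mem_sInf]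
    exact fun P hP => hP.1 ⟨u, v, w, rfl⟩

/-- The subspace `I ⊗ 𝕋 + 𝕋 ⊗ I` of `𝕋 ⊗ 𝕋`. -/
noncomputable def assocIdeal2 : Submodule K (TreeSpace K ⊗[K] TreeSpace K) :=
  LinearMap.range (TensorProduct.map (assocIdeal K).subtype
      (LinearMap.id : TreeSpace K →ₗ[K] TreeSpace K)) ⊔
    LinearMap.range (TensorProduct.map
      (LinearMap.id : TreeSpace K →ₗ[K] TreeSpace K) (assocIdeal K).subtype)

theorem tmul_mem_assocIdeal2_left {x : TreeSpace K} (hx : x ∈ assocIdeal K)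
    (y : TreeSpace K) : x ⊗ₜ[K] y ∈ assocIdeal2 K :=
  Submodule.mem_sup_left ⟨(⟨x, hx⟩ : assocIdeal K) ⊗ₜ y, rfl⟩

theorem tmul_mem_assocIdeal2_right (x : TreeSpace K) {y : TreeSpace K}
    (hy : y ∈ assocIdeal K) : x ⊗ₜ[K] y ∈ assocIdeal2 K :=
  Submodule.mem_sup_right ⟨x ⊗ₜ (⟨y, hy⟩ : assocIdeal K), rfl⟩

theorem assocIdeal2_le {P : Submodule K (TreeSpace K ⊗[K] TreeSpace K)}
    (hl : ∀ x ∈ assocIdeal K, ∀ y, x ⊗ₜ[K] y ∈ P)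
    (hr : ∀ x, ∀ y ∈ assocIdeal K, x ⊗ₜ[K] y ∈ P) : assocIdeal2 K ≤ P := by
  refine sup_le ?_ ?_ <;> rw [LinearMap.range_eq_map, Submodule.map_le_iff_le_comap] <;>
    rintro z - <;> rw [Submodule.mem_comap]
  · induction z using TensorProduct.induction_on with
    | zero => simp
    | add z z' hz hz' => rw [map_add]; exact add_mem hz hz'
    | tmul x y => exact hl x x.2 y
  · induction z using TensorProduct.induction_on with
    | zero => simp
    | add z z' hz hz' => rw [map_add]; exact add_mem hz hz'
    | tmul x y => exact hr x y y.2

theorem treeVee2_mem_assocIdeal2_right (t : TreeSpace K ⊗[K] TreeSpace K)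
    {z : TreeSpace K ⊗[K] TreeSpace K} (hz : z ∈ assocIdeal2 K) :
    treeVee2 K t z ∈ assocIdeal2 K := by
  induction t using TensorProduct.induction_on with
  | zero => simp
  | add t t' ht ht' => rw [map_add]; exact add_mem ht ht'
  | tmul a b =>
    have h : assocIdeal2 K ≤ (assocIdeal2 K).comap (treeVee2 K (a ⊗ₜ b)) :=
      assocIdeal2_le K
        (fun _ hx _ => tmul_mem_assocIdeal2_left K (treeVee_mem_assocIdeal_right K a hx) _)
        (fun _ _ hy => tmul_mem_assocIdeal2_right K _ (treeVee_mem_assocIdeal_right K b hy))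
    exact h hz

theorem treeVee2_mem_assocIdeal2_left {z : TreeSpace K ⊗[K] TreeSpace K}
    (hz : z ∈ assocIdeal2 K) (t : TreeSpace K ⊗[K] TreeSpace K) :
    treeVee2 K z t ∈ assocIdeal2 K := by
  induction t using TensorProduct.induction_on with
  | zero => simp
  | add t t' ht ht' => rw [map_add]; exact add_mem ht ht'
  | tmul a b =>
    have h : assocIdeal2 K ≤ (assocIdeal2 K).comap ((treeVee2 K).flip (a ⊗ₜ b)) :=
      assocIdeal2_le K
        (fun _ hx _ => tmul_mem_assocIdeal2_left K (treeVee_mem_assocIdeal_left K hx a) _)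
        (fun _ _ hy => tmul_mem_assocIdeal2_right K _ (treeVee_mem_assocIdeal_left K hy b))
    exact h hz

theorem tensor_add_sub_add_comm (p q r s : TreeSpace K ⊗[K] TreeSpace K) :
    p + q - (r + s) = p - r + (q - s) :=
  add_sub_add_comm p q r s

/-- The Hom-associator of the componentwise product on `𝕋 ⊗ 𝕋` takes values in
`I ⊗ 𝕋 + 𝕋 ⊗ I`. -/
theorem homAssociator_mem_assocIdeal2 (x y z : TreeSpace K ⊗[K] TreeSpace K) :
    treeVee2 K (treeVee2 K x y) (treeAlpha2 K z)
      - treeVee2 K (treeAlpha2 K x) (treeVee2 K y z) ∈ assocIdeal2 K := by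
  induction x using TensorProduct.induction_on with
  | zero => simp
  | add x x' hx hx' =>
    simp only [map_add, LinearMap.add_apply]
    rw [tensor_add_sub_add_comm]
    exact add_mem hx hx'
  | tmul a a' =>
  induction y using TensorProduct.induction_on with
  | zero => simp
  | add y y' hy hy' =>
    simp only [map_add, LinearMap.add_apply]
    rw [tensor_add_sub_add_comm]
    exact add_mem hy hy'
  | tmul b b' =>
  induction z using TensorProduct.induction_on with
  | zero => simp
  | add z z' hz hz' =>
    simp only [map_add]
    rw [tensor_add_sub_add_comm]
    exact add_mem hz hz'
  | tmul c c' =>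
    simp only [treeVee2_tmul, treeAlpha2_tmul]
    rw [← sub_add_sub_cancel _ (treeVee K (treeAlpha K a) (treeVee K b c) ⊗ₜ[K]
      treeVee K (treeVee K a' b') (treeAlpha K c')), ← sub_tmul, ← tmul_sub]
    exact add_mem (tmul_mem_assocIdeal2_left K (homAssociator_mem_assocIdeal K a b c) _)
      (tmul_mem_assocIdeal2_right K _ (homAssociator_mem_assocIdeal K a' b' c'))

/-- The Hom-associativity ideal `I` is a coideal of the coalgebra `(𝕋, Δ, ε)`:
`ε(I) = 0` and `Δ(I) ⊆ I⊗𝕋 + 𝕋⊗I`. -/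
theorem assocIdeal_is_coideal (K : Type*) [Field K] :
    (∀ x ∈ assocIdeal K, treeEps K x = 0) ∧
    (∀ x ∈ assocIdeal K,
      treeDelta K x ∈
        LinearMap.range (TensorProduct.map (assocIdeal K).subtype
          (LinearMap.id : TreeSpace K →ₗ[K] TreeSpace K)) ⊔
        LinearMap.range (TensorProduct.map
          (LinearMap.id : TreeSpace K →ₗ[K] TreeSpace K) (assocIdeal K).subtype)) := by
  constructor
  · have h : assocIdeal K ≤ LinearMap.ker (treeEps K) := by
      refine assocIdeal_le K ?_ ?_ ?_
      · rintro _ ⟨u, v, w, rfl⟩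
        simp only [SetLike.mem_coe, LinearMap.mem_ker, map_sub, treeEps_treeVee,
          treeEps_treeAlpha, mul_assoc, sub_self]
      · intro t x hx
        rw [LinearMap.mem_ker] at hx ⊢
        rw [treeEps_treeVee, hx, mul_zero]
      · intro t x hx
        rw [LinearMap.mem_ker] at hx ⊢
        rw [treeEps_treeVee, hx, zero_mul]
    exact fun x hx => h hx
  · have h : assocIdeal K ≤ (assocIdeal2 K).comap (treeDelta K) := by
      refine assocIdeal_le K ?_ ?_ ?_
      · rintro _ ⟨u, v, w, rfl⟩
        simp only [SetLike.mem_coe, Submodule.mem_comap, map_sub, treeDelta_treeVee,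
          treeDelta_treeAlpha]
        exact homAssociator_mem_assocIdeal2 K _ _ _
      · intro t x hx
        rw [Submodule.mem_comap] at hx ⊢
        rw [treeDelta_treeVee]
        exact treeVee2_mem_assocIdeal2_right K _ hx
      · intro t x hx
        rw [Submodule.mem_comap] at hx ⊢
        rw [treeDelta_treeVee]
        exact treeVee2_mem_assocIdeal2_left K hx _
    exact fun x hx => h hx
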